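/- Let I = (0,1), ρ₀(x) = min(x,1-x), and suppose g ∈ C¹([0,1]). Then ‖g‖_{L⁴(I)} ≤ C ‖g‖_{H^{1/2}(I)} ≤ C' (∫_I ρ₀ (g² + gₓ²) dx)^{1/2} for absolute constants C, C'. -/

import Mathlib

open Set MeasureTheory

theorem exists_C1_extension {g g' : ℝ → ℝ}
    (hg : ∀ x ∈ Icc (0:ℝ) 1, HasDerivWithinAt g (g' x) (Icc (0:ℝ) 1) x)
    (hg' : ContinuousOn g' (Icc (0:ℝ) 1)) :
    ∃ f f' : ℝ → ℝ, (∀ x, HasDerivAt f (f' x) x) ∧ Continuous f' ∧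
      EqOn f g (Icc 0 1) ∧ EqOn f' g' (Icc 0 1) := by
  set f' : ℝ → ℝ := IccExtend zero_le_one ((Icc (0:ℝ) 1).domRestrict g') with hf'
  have hc : Continuous f' := hg'.domRestrict.Icc_extend'
  have he : EqOn f' g' (Icc 0 1) := fun x hx ↦ by
    simp [hf', IccExtend_of_mem zero_le_one _ hx, domRestrict_apply]
  refine ⟨fun x ↦ g 0 + ∫ t in (0:ℝ)..x, f' t, f', fun x ↦ ?_, hc, fun x hx ↦ ?_, he⟩
  · exact (hc.integral_hasStrictDerivAt 0 x).hasDerivAt.const_add _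
  · have hsub : Icc 0 x ⊆ Icc (0:ℝ) 1 := Icc_subset_Icc_right hx.2
    have := intervalIntegral.integral_eq_sub_of_hasDerivAt_of_le (f := g) (f' := f') hx.1
      (fun y hy ↦ ((hg y (hsub hy)).continuousWithinAt).mono hsub)
      (fun y hy ↦ by
        rw [he (hsub (Ioo_subset_Icc_self hy))]
        exact (hg y (hsub (Ioo_subset_Icc_self hy))).hasDerivAt
          (Icc_mem_nhds hy.1 (hy.2.trans_le hx.2)))
      (hc.intervalIntegrable _ _)
    simp only [this]
    ring

/-- The difference quotient of a primitive of `f'`, extended continuously to the diagonal. -/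
noncomputable def meanDeriv (f' : ℝ → ℝ) (x y : ℝ) : ℝ := ∫ t in (0:ℝ)..1, f' (x + t * (y - x))

theorem continuous_meanDeriv {f' : ℝ → ℝ} (hf' : Continuous f') :
    Continuous fun p : ℝ × ℝ ↦ meanDeriv f' p.1 p.2 := by
  unfold meanDeriv
  apply intervalIntegral.continuous_parametric_intervalIntegral_of_continuous'
  simp only [Function.uncurry_def]
  fun_prop

theorem sub_eq_mul_meanDeriv {f f' : ℝ → ℝ} (hf : ∀ x, HasDerivAt f (f' x) x)
    (hf' : Continuous f') (x y : ℝ) : f y - f x = (y - x) * meanDeriv f' x y := by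
  have h : ∀ t ∈ uIcc (0:ℝ) 1,
      HasDerivAt (fun t ↦ f (x + t * (y - x))) (f' (x + t * (y - x)) * (y - x)) t := by
    intro t _
    have h1 : HasDerivAt (fun t ↦ x + t * (y - x)) (1 * (y - x)) t :=
      ((hasDerivAt_id t).mul_const (y - x)).const_add x
    simpa [Function.comp_def] using (hf _).comp t h1
  have := intervalIntegral.integral_eq_sub_of_hasDerivAt h
    (Continuous.intervalIntegrable (by fun_prop) _ _)
  rw [intervalIntegral.integral_mul_const] at this
  simp only [one_mul, zero_mul, add_zero, add_sub_cancel] at this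
  rw [← this, meanDeriv, mul_comm]

theorem meanDeriv_comm {f f' : ℝ → ℝ} (hf : ∀ x, HasDerivAt f (f' x) x)
    (hf' : Continuous f') (x y : ℝ) : meanDeriv f' x y = meanDeriv f' y x := by
  rcases eq_or_ne x y with rfl | h
  · rfl
  · have h1 := sub_eq_mul_meanDeriv hf hf' x y
    have h2 := sub_eq_mul_meanDeriv hf hf' y x
    have h3 : y - x ≠ 0 := sub_ne_zero.2 h.symm
    apply mul_left_cancel₀ h3
    linear_combination -h1 - h2

/-- Hardy's inequality. -/
theorem integral_meanDeriv_sq_le {f f' : ℝ → ℝ} (hf : ∀ x, HasDerivAt f (f' x) x)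
    (hf' : Continuous f') {a b c : ℝ} (hac : a ≤ c) (hcb : c ≤ b) :
    ∫ y in a..b, meanDeriv f' c y ^ 2 ≤ 4 * ∫ y in a..b, f' y ^ 2 := by
  have hd : Continuous (meanDeriv f' c) :=
    (continuous_meanDeriv hf').comp (Continuous.prodMk_right c)
  have hcont : Continuous f := continuous_iff_continuousAt.2 fun x ↦ (hf x).continuousAt
  have hP : ∀ y ∈ Ioo a b \ {c}, HasDerivAt (fun y ↦ (y - c) * meanDeriv f' c y ^ 2)
      (2 * meanDeriv f' c y * f' y - meanDeriv f' c y ^ 2) y := by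
    rintro y ⟨-, hy⟩
    have hyc : y - c ≠ 0 := sub_ne_zero.2 hy
    have h1 : HasDerivAt (fun y ↦ (f y - f c) ^ 2 / (y - c)) _ y :=
      (((hf y).sub_const (f c)).pow 2).div ((hasDerivAt_id y).sub_const c) hyc
    convert h1 using 1
    · ext z
      rw [sub_eq_mul_meanDeriv hf hf' c z]
      rcases eq_or_ne z c with rfl | hz
      · simp
      · have : z - c ≠ 0 := sub_ne_zero.2 hz
        field_simp
    · simp only [Pi.pow_apply, sub_eq_mul_meanDeriv hf hf' c y]
      field_simp
      push_cast
      ring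
  have hF := integral_eq_of_hasDerivAt_off_countable_of_le
    (fun y ↦ (y - c) * meanDeriv f' c y ^ 2) _ (hac.trans hcb) (countable_singleton c)
    (by fun_prop) hP (Continuous.intervalIntegrable (by fun_prop) _ _)
  have hle : ∫ y in a..b, ((2 * meanDeriv f' c y * f' y - meanDeriv f' c y ^ 2) * 2
      + meanDeriv f' c y ^ 2) ≤ ∫ y in a..b, 4 * f' y ^ 2 :=
    intervalIntegral.integral_mono (hac.trans hcb)
      (Continuous.intervalIntegrable (by fun_prop) _ _)
      (Continuous.intervalIntegrable (by fun_prop) _ _)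
      fun y ↦ by nlinarith [sq_nonneg (2 * f' y - meanDeriv f' c y)]
  rw [intervalIntegral.integral_add (Continuous.intervalIntegrable (by fun_prop) _ _)
      (Continuous.intervalIntegrable (by fun_prop) _ _), intervalIntegral.integral_mul_const,
    intervalIntegral.integral_const_mul, hF] at hle
  have h1 : 0 ≤ (b - c) * meanDeriv f' c b ^ 2 := mul_nonneg (by linarith) (sq_nonneg _)
  have h2 : 0 ≤ (c - a) * meanDeriv f' c a ^ 2 := mul_nonneg (by linarith) (sq_nonneg _)
  linarith

theorem integral_sq_le_weighted {f f' : ℝ → ℝ} (hf : ∀ x, HasDerivAt f (f' x) x)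
    (hf' : Continuous f') :
    ∫ x in (0:ℝ)..1, f x ^ 2 ≤ 7 * ∫ x in (0:ℝ)..1, min x (1 - x) * (f x ^ 2 + f' x ^ 2) := by
  have hcont : Continuous f := continuous_iff_continuousAt.2 fun x ↦ (hf x).continuousAt
  have hderiv : ∀ x ∈ uIcc (0:ℝ) 1,
      HasDerivAt (fun x ↦ (x * (1 - x) * (2 * x - 1)) * f x ^ 2)
        ((6 * (x * (1 - x)) - 1) * f x ^ 2 +
          2 * (x * (1 - x) * (2 * x - 1)) * (f x * f' x)) x := by
    intro x _
    have h0 : HasDerivAt (fun x : ℝ ↦ x * (1 - x) * (2 * x - 1)) _ x :=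
      ((hasDerivAt_id x).mul ((hasDerivAt_id x).const_sub 1)).mul
        (((hasDerivAt_id x).const_mul 2).sub_const 1)
    refine (h0.mul ((hf x).pow 2)).congr_deriv ?_
    simp only [id, Pi.mul_apply, Pi.pow_apply]
    push_cast
    ring
  have hF := intervalIntegral.integral_eq_sub_of_hasDerivAt hderiv
    (Continuous.intervalIntegrable (by fun_prop) _ _)
  have hle : ∫ x in (0:ℝ)..1, (f x ^ 2 + ((6 * (x * (1 - x)) - 1) * f x ^ 2 +
          2 * (x * (1 - x) * (2 * x - 1)) * (f x * f' x))) ≤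
      ∫ x in (0:ℝ)..1, 7 * (min x (1 - x) * (f x ^ 2 + f' x ^ 2)) := by
    refine intervalIntegral.integral_mono_on zero_le_one
      (Continuous.intervalIntegrable (by fun_prop) _ _)
      (Continuous.intervalIntegrable (by fun_prop) _ _) fun x hx ↦ ?_
    have hx0 := hx.1
    have hx1 : 0 ≤ 1 - x := sub_nonneg.2 hx.2
    have hp : 0 ≤ x * (1 - x) := mul_nonneg hx0 hx1
    have hm : x * (1 - x) ≤ min x (1 - x) := le_min (by nlinarith) (by nlinarith)
    have hq : 2 * (2 * x - 1) * (f x * f' x) ≤ f x ^ 2 + f' x ^ 2 := by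
      nlinarith [sq_nonneg (f x - (2 * x - 1) * f' x),
        mul_nonneg hp (sq_nonneg (f' x))]
    have := mul_le_mul_of_nonneg_left hq hp
    have := mul_le_mul_of_nonneg_right hm (add_nonneg (sq_nonneg (f x)) (sq_nonneg (f' x)))
    nlinarith [mul_nonneg hp (sq_nonneg (f' x))]
  rw [intervalIntegral.integral_add (Continuous.intervalIntegrable (by fun_prop) _ _)
      (Continuous.intervalIntegrable (by fun_prop) _ _), hF,
    intervalIntegral.integral_const_mul] at hle
  simpa using hle

theorem sq_le_of_forall_mul_le {G N D : ℝ} (hG : 0 ≤ G) (hN : 0 ≤ N) (hD : 0 ≤ D)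
    (h : ∀ r, 0 < r → r ≤ 1 → r * G ≤ 2 * N + 2 * r ^ 2 * D) : G ^ 2 ≤ 16 * (N * (N + D)) := by
  rcases hG.eq_or_lt with rfl | hG
  · rw [zero_pow two_ne_zero]
    positivity
  have h1 := h 1 one_pos le_rfl
  have hS : 0 < N + D := by linarith
  have h2 := h (G / (4 * (N + D))) (by positivity)
    ((div_le_one (by positivity)).2 (by linarith))
  have e1 : G / (4 * (N + D)) * G * (8 * (N + D)) = 2 * G ^ 2 := by
    field_simp
    norm_num
  have e2 : (2 * N + 2 * (G / (4 * (N + D))) ^ 2 * D) * (8 * (N + D)) =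
      16 * (N * (N + D)) + G ^ 2 * (D / (N + D)) := by
    field_simp
    ring
  have h3 := mul_le_mul_of_nonneg_right h2 (by positivity : 0 ≤ 8 * (N + D))
  rw [e1, e2] at h3
  have h4 : G ^ 2 * (D / (N + D)) ≤ G ^ 2 * 1 :=
    mul_le_mul_of_nonneg_left ((div_le_one hS).2 (by linarith)) (sq_nonneg G)
  linarith

theorem pow_four_le {f f' : ℝ → ℝ} (hf : ∀ x, HasDerivAt f (f' x) x) (hf' : Continuous f')
    {x : ℝ} (hx : x ∈ Icc (0:ℝ) 1) :
    f x ^ 4 ≤ 16 * ((∫ y in (0:ℝ)..1, f y ^ 2) *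
      ((∫ y in (0:ℝ)..1, f y ^ 2) + ∫ y in (0:ℝ)..1, meanDeriv f' x y ^ 2)) := by
  have hcont : Continuous f := continuous_iff_continuousAt.2 fun x ↦ (hf x).continuousAt
  have hd : Continuous (meanDeriv f' x) :=
    (continuous_meanDeriv hf').comp (Continuous.prodMk_right x)
  rw [show f x ^ 4 = (f x ^ 2) ^ 2 by ring]
  refine sq_le_of_forall_mul_le (sq_nonneg _)
    (intervalIntegral.integral_nonneg zero_le_one fun y _ ↦ sq_nonneg _)
    (intervalIntegral.integral_nonneg zero_le_one fun y _ ↦ sq_nonneg _) fun r hr0 hr1 ↦ ?_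
  set a := x * (1 - r) with ha
  have ha0 : 0 ≤ a := mul_nonneg hx.1 (by linarith)
  have ha1 : a + r ≤ 1 := by nlinarith [hx.2]
  have hax : a ≤ x := by nlinarith [hx.1]
  have hxa : x ≤ a + r := by nlinarith [hx.2]
  calc r * f x ^ 2 = ∫ _ in a..(a + r), f x ^ 2 := by simp
    _ ≤ ∫ y in a..(a + r), (2 * f y ^ 2 + 2 * r ^ 2 * meanDeriv f' x y ^ 2) := by
      refine intervalIntegral.integral_mono_on (by linarith)
        (Continuous.intervalIntegrable (by fun_prop) _ _)
        (Continuous.intervalIntegrable (by fun_prop) _ _) fun y hy ↦ ?_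
      have e := sub_eq_mul_meanDeriv hf hf' x y
      have hr : (y - x) ^ 2 ≤ r ^ 2 :=
        sq_le_sq' (by linarith [hy.1]) (by linarith [hy.2])
      have e2 : (f y - f x) ^ 2 = (y - x) ^ 2 * meanDeriv f' x y ^ 2 := by rw [e]; ring
      nlinarith [mul_le_mul_of_nonneg_right hr (sq_nonneg (meanDeriv f' x y)),
        sq_nonneg (2 * f y - f x)]
    _ ≤ ∫ y in (0:ℝ)..1, (2 * f y ^ 2 + 2 * r ^ 2 * meanDeriv f' x y ^ 2) := by
      refine intervalIntegral.integral_mono_interval ha0 (by linarith) ha1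
        (Filter.Eventually.of_forall fun y ↦ ?_)
        (Continuous.intervalIntegrable (by fun_prop) _ _)
      simp only [Pi.zero_apply]
      positivity
    _ = _ := by
      rw [intervalIntegral.integral_add (Continuous.intervalIntegrable (by fun_prop) _ _)
        (Continuous.intervalIntegrable (by fun_prop) _ _), intervalIntegral.integral_const_mul,
        intervalIntegral.integral_const_mul]

theorem integral_pow_four_le {f f' : ℝ → ℝ} (hf : ∀ x, HasDerivAt f (f' x) x)
    (hf' : Continuous f') :
    ∫ x in (0:ℝ)..1, f x ^ 4 ≤ 16 * ((∫ x in (0:ℝ)..1, f x ^ 2) +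
      ∫ x in (0:ℝ)..1, ∫ y in (0:ℝ)..1, meanDeriv f' x y ^ 2) ^ 2 := by
  have hcont : Continuous f := continuous_iff_continuousAt.2 fun x ↦ (hf x).continuousAt
  have hD : Continuous fun x ↦ ∫ y in (0:ℝ)..1, meanDeriv f' x y ^ 2 :=
    intervalIntegral.continuous_parametric_intervalIntegral_of_continuous'
      ((continuous_meanDeriv hf').pow 2) 0 1
  have hle := intervalIntegral.integral_mono_on zero_le_one
    (Continuous.intervalIntegrable (μ := volume) (by fun_prop) _ _)
    (Continuous.intervalIntegrable (by fun_prop) _ _) fun x hx ↦ pow_four_le hf hf' hx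
  rw [intervalIntegral.integral_const_mul, intervalIntegral.integral_const_mul,
    intervalIntegral.integral_add (Continuous.intervalIntegrable (by fun_prop) _ _)
      (hD.intervalIntegrable _ _)] at hle
  simp only [intervalIntegral.integral_const, sub_zero, one_smul] at hle
  have hN : 0 ≤ ∫ x in (0:ℝ)..1, f x ^ 2 :=
    intervalIntegral.integral_nonneg zero_le_one fun y _ ↦ sq_nonneg _
  have hS : 0 ≤ ∫ x in (0:ℝ)..1, ∫ y in (0:ℝ)..1, meanDeriv f' x y ^ 2 :=
    intervalIntegral.integral_nonneg zero_le_one fun x _ ↦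
      intervalIntegral.integral_nonneg zero_le_one fun y _ ↦ sq_nonneg _
  nlinarith [mul_nonneg hN hS, mul_nonneg hS hS]

/-- The region between the vertical sides of the unit square and its diagonals. -/
def bowtie : Set (ℝ × ℝ) := {p | |p.2 - 1 / 2| ≤ |p.1 - 1 / 2|}

theorem measurableSet_bowtie : MeasurableSet bowtie :=
  (isClosed_le (by fun_prop) (by fun_prop)).measurableSet

theorem integrable_unitSquare {K : ℝ × ℝ → ℝ} (hK : Continuous K) :
    Integrable K ((volume.restrict (Ioc (0:ℝ) 1)).prod (volume.restrict (Ioc (0:ℝ) 1))) := by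
  rw [Measure.prod_restrict]
  exact (hK.continuousOn.integrableOn_compact (isCompact_Icc.prod isCompact_Icc)).mono_set
    (prod_mono Ioc_subset_Icc_self Ioc_subset_Icc_self)

theorem integral_symm_le {K : ℝ × ℝ → ℝ} (hK : Continuous K) (h0 : ∀ p, 0 ≤ K p)
    (hs : ∀ p, K p.swap = K p) :
    ∫ x in Ioc (0:ℝ) 1, ∫ y in Ioc (0:ℝ) 1, K (x, y) ≤
      2 * ∫ x in Ioc (0:ℝ) 1, ∫ y in Ioc (0:ℝ) 1, bowtie.indicator K (x, y) := by
  have hI := integrable_unitSquare hK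
  have hA := hI.indicator measurableSet_bowtie
  rw [← integral_prod _ hI, ← integral_prod _ hA]
  have hle := integral_mono hI (hA.add hA.swap) fun p ↦ by
    have h1 : 0 ≤ bowtie.indicator K p := indicator_nonneg (fun p _ ↦ h0 p) p
    have h2 : 0 ≤ bowtie.indicator K p.swap := indicator_nonneg (fun p _ ↦ h0 p) _
    change K p ≤ bowtie.indicator K p + bowtie.indicator K p.swap
    rcases le_total |p.2 - 1 / 2| |p.1 - 1 / 2| with h | h
    · rw [indicator_of_mem (show p ∈ bowtie from h)]
      linarith
    · rw [indicator_of_mem (show p.swap ∈ bowtie from h), hs]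
      linarith
  rw [integral_add' hA hA.swap] at hle
  have := integral_prod_swap (μ := volume.restrict (Ioc (0:ℝ) 1))
    (ν := volume.restrict (Ioc (0:ℝ) 1)) (bowtie.indicator K)
  simp only [Function.comp_def] at hle
  linarith

theorem mem_bowtie_iff (x y : ℝ) :
    (x, y) ∈ bowtie ↔ y ∈ Icc (min x (1 - x)) (max x (1 - x)) := by
  simp only [bowtie, mem_ofPred_eq, mem_Icc, abs_le, min_le_iff, le_max_iff]
  rcases abs_cases (x - 1 / 2) with ⟨h, h'⟩ | ⟨h, h'⟩ <;> rw [h] <;> grind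

theorem integral_bowtie_section {φ : ℝ × ℝ → ℝ} {x : ℝ} (hx : x ∈ Ioc (0:ℝ) 1) :
    ∫ y in Ioc (0:ℝ) 1, bowtie.indicator φ (x, y) =
      ∫ y in (min x (1 - x))..(max x (1 - x)), φ (x, y) := by
  have h0 : 0 ≤ min x (1 - x) := le_min hx.1.le (by linarith [hx.2])
  have h1 : max x (1 - x) ≤ 1 := max_le hx.2 (by linarith [hx.1])
  have e : (fun y ↦ bowtie.indicator φ (x, y)) =
      (Icc (min x (1 - x)) (max x (1 - x))).indicator fun y ↦ φ (x, y) := by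
    ext y
    by_cases h : (x, y) ∈ bowtie
    · rw [indicator_of_mem h, indicator_of_mem ((mem_bowtie_iff x y).1 h)]
    · rw [indicator_of_notMem h, indicator_of_notMem (mt (mem_bowtie_iff x y).2 h)]
  rw [e, setIntegral_indicator measurableSet_Icc,
    intervalIntegral.integral_of_le min_le_max]
  have := (ae_eq_refl (μ := volume) (Ioc (0:ℝ) 1)).inter
    (Ioc_ae_eq_Icc (μ := volume) (a := min x (1 - x)) (b := max x (1 - x))).symm
  rw [setIntegral_congr_set this, inter_eq_right.2 (Ioc_subset_Ioc h0 h1)]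

theorem volume_bowtie_section_le {y : ℝ} (hy : y ∈ Ioc (0:ℝ) 1) :
    volume.real (Ioc (0:ℝ) 1 ∩ {x | (x, y) ∈ bowtie}) ≤ 2 * min y (1 - y) := by
  have h0 : 0 ≤ min y (1 - y) := le_min hy.1.le (by linarith [hy.2])
  have hsub : Ioc (0:ℝ) 1 ∩ {x | (x, y) ∈ bowtie} ⊆
      Icc 0 (min y (1 - y)) ∪ Icc (1 - min y (1 - y)) 1 := by
    rintro x ⟨hx, h⟩
    rw [mem_ofPred_eq, mem_bowtie_iff] at h
    simp only [mem_union, mem_Icc, mem_Ioc] at *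
    grind
  calc _ ≤ volume.real (Icc 0 (min y (1 - y)) ∪ Icc (1 - min y (1 - y)) 1) :=
        measureReal_mono hsub (measure_union_lt_top measure_Icc_lt_top measure_Icc_lt_top).ne
    _ ≤ _ := measureReal_union_le _ _
    _ = _ := by
      rw [Real.volume_real_Icc_of_le h0, Real.volume_real_Icc_of_le (by linarith)]
      ring

theorem integral_bowtie_le {φ : ℝ → ℝ} (hφ : Continuous φ) (h0 : ∀ y, 0 ≤ φ y) :
    ∫ x in Ioc (0:ℝ) 1, ∫ y in Ioc (0:ℝ) 1, bowtie.indicator (fun p ↦ φ p.2) (x, y) ≤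
      ∫ y in Ioc (0:ℝ) 1, 2 * min y (1 - y) * φ y := by
  have hI := (integrable_unitSquare (hφ.comp continuous_snd)).indicator measurableSet_bowtie
  rw [integral_integral_swap (f := fun x y ↦ bowtie.indicator (fun p ↦ φ p.2) (x, y)) hI]
  refine setIntegral_mono_on hI.integral_prod_right
    (Continuous.integrableOn_Ioc (by fun_prop)) measurableSet_Ioc fun y hy ↦ ?_
  have hm : MeasurableSet {x | (x, y) ∈ bowtie} := measurableSet_bowtie.preimage (by fun_prop)
  have e : ∫ x in Ioc (0:ℝ) 1, bowtie.indicator (fun p : ℝ × ℝ ↦ φ p.2) (x, y) =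
      ∫ x in Ioc (0:ℝ) 1, {x | (x, y) ∈ bowtie}.indicator (fun _ ↦ φ y) x := rfl
  rw [e, setIntegral_indicator hm, setIntegral_const, smul_eq_mul]
  exact mul_le_mul_of_nonneg_right (volume_bowtie_section_le hy) (h0 y)

theorem integral_meanDeriv_sq_le_weighted {f f' : ℝ → ℝ} (hf : ∀ x, HasDerivAt f (f' x) x)
    (hf' : Continuous f') :
    ∫ x in (0:ℝ)..1, ∫ y in (0:ℝ)..1, meanDeriv f' x y ^ 2 ≤
      16 * ∫ x in (0:ℝ)..1, min x (1 - x) * f' x ^ 2 := by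
  simp only [intervalIntegral.integral_of_le zero_le_one]
  have hK : Continuous fun p : ℝ × ℝ ↦ meanDeriv f' p.1 p.2 ^ 2 := (continuous_meanDeriv hf').pow 2
  have hφ : Continuous fun y ↦ f' y ^ 2 := hf'.pow 2
  have h1 := integral_symm_le hK (fun p ↦ sq_nonneg _) fun p ↦ by
    simp only [Prod.fst_swap, Prod.snd_swap, meanDeriv_comm hf hf' p.1 p.2]
  have hI1 := ((integrable_unitSquare hK).indicator measurableSet_bowtie).integral_prod_left
  have hI2 := ((integrable_unitSquare (hφ.comp continuous_snd)).indicator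
    measurableSet_bowtie).integral_prod_left
  have h2 := setIntegral_mono_on hI1 (hI2.const_mul 4) measurableSet_Ioc fun x hx ↦ by
    simp only [Function.comp_def]
    rw [integral_bowtie_section hx, integral_bowtie_section hx]
    exact integral_meanDeriv_sq_le hf hf' (min_le_left _ _) (le_max_left _ _)
  have h3 := integral_bowtie_le hφ fun y ↦ sq_nonneg _
  rw [integral_const_mul] at h2
  simp only [mul_assoc, integral_const_mul] at h3
  simp only [Function.comp_def] at h2
  linarith

theorem integral_gagliardo_eq {f f' : ℝ → ℝ} (hf : ∀ x, HasDerivAt f (f' x) x)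
    (hf' : Continuous f') (x : ℝ) :
    ∫ y in (0:ℝ)..1, (f x - f y) ^ 2 / |x - y| ^ 2 =
      ∫ y in (0:ℝ)..1, meanDeriv f' x y ^ 2 := by
  refine intervalIntegral.integral_congr_ae ?_
  have : ∀ᵐ y : ℝ, y ≠ x := by simp [ae_iff]
  filter_upwards [this] with y hy _
  have h : x - y ≠ 0 := sub_ne_zero.2 hy.symm
  rw [sq_abs, div_eq_iff (by positivity)]
  have := sub_eq_mul_meanDeriv hf hf' x y
  rw [show f x - f y = (x - y) * meanDeriv f' x y by linear_combination -this]
  ring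

/-- Combination of the fractional embedding `H^{1/2}(0,1) ↪ L⁴(0,1)` and the
weighted Sobolev inequality (3.1): with `ρ₀ x = min x (1-x)`,
`‖g‖_{L⁴} ≤ C ‖g‖_{H^{1/2}} ≤ C' (∫ ρ₀ (g² + gₓ²))^{1/2}`. -/
theorem L4_Hhalf_weighted_chain :
    ∃ C C' : ℝ, 0 < C ∧ 0 < C' ∧
      ∀ g g' : ℝ → ℝ,
        (∀ x ∈ Icc (0:ℝ) 1, HasDerivWithinAt g (g' x) (Icc (0:ℝ) 1) x) →
        ContinuousOn g' (Icc (0:ℝ) 1) →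
        (∫ x in (0:ℝ)..1, (g x) ^ 4) ^ ((1:ℝ)/4) ≤
            C * Real.sqrt ((∫ x in (0:ℝ)..1, (g x) ^ 2) +
              ∫ x in (0:ℝ)..1, ∫ y in (0:ℝ)..1, (g x - g y) ^ 2 / |x - y| ^ 2) ∧
        C * Real.sqrt ((∫ x in (0:ℝ)..1, (g x) ^ 2) +
              ∫ x in (0:ℝ)..1, ∫ y in (0:ℝ)..1, (g x - g y) ^ 2 / |x - y| ^ 2) ≤
          C' * Real.sqrt (∫ x in (0:ℝ)..1,
              min x (1 - x) * ((g x) ^ 2 + (g' x) ^ 2)) := by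
  refine ⟨2, 10, by norm_num, by norm_num, fun g g' hg hg' ↦ ?_⟩
  obtain ⟨f, f', hf, hf', hfg, hfg'⟩ := exists_C1_extension hg hg'
  have hu : ∀ {x : ℝ}, x ∈ uIcc (0:ℝ) 1 → x ∈ Icc (0:ℝ) 1 := fun hx ↦ by
    rwa [uIcc_of_le zero_le_one] at hx
  have e4 : ∫ x in (0:ℝ)..1, g x ^ 4 = ∫ x in (0:ℝ)..1, f x ^ 4 :=
    intervalIntegral.integral_congr fun x hx ↦ by simp only [hfg (hu hx)]
  have e2 : ∫ x in (0:ℝ)..1, g x ^ 2 = ∫ x in (0:ℝ)..1, f x ^ 2 :=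
    intervalIntegral.integral_congr fun x hx ↦ by simp only [hfg (hu hx)]
  have ew : ∫ x in (0:ℝ)..1, min x (1 - x) * (g x ^ 2 + g' x ^ 2) =
      ∫ x in (0:ℝ)..1, min x (1 - x) * (f x ^ 2 + f' x ^ 2) :=
    intervalIntegral.integral_congr fun x hx ↦ by simp only [hfg (hu hx), hfg' (hu hx)]
  have ed : ∫ x in (0:ℝ)..1, ∫ y in (0:ℝ)..1, (g x - g y) ^ 2 / |x - y| ^ 2 =
      ∫ x in (0:ℝ)..1, ∫ y in (0:ℝ)..1, meanDeriv f' x y ^ 2 :=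
    intervalIntegral.integral_congr fun x hx ↦ by
      rw [← integral_gagliardo_eq hf hf' x]
      exact intervalIntegral.integral_congr fun y hy ↦ by simp only [hfg (hu hx), hfg (hu hy)]
  rw [e4, e2, ew, ed]
  have hcont : Continuous f := continuous_iff_continuousAt.2 fun x ↦ (hf x).continuousAt
  have h4 := integral_pow_four_le hf hf'
  have h2 := integral_sq_le_weighted hf hf'
  have hd := integral_meanDeriv_sq_le_weighted hf hf'
  have hw : ∫ x in (0:ℝ)..1, min x (1 - x) * f' x ^ 2 ≤
      ∫ x in (0:ℝ)..1, min x (1 - x) * (f x ^ 2 + f' x ^ 2) :=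
    intervalIntegral.integral_mono_on zero_le_one
      (Continuous.intervalIntegrable (by fun_prop) _ _)
      (Continuous.intervalIntegrable (by fun_prop) _ _) fun x hx ↦
        mul_le_mul_of_nonneg_left (by linarith [sq_nonneg (f x)])
          (le_min hx.1 (by linarith [hx.2]))
  have hX : 0 ≤ ∫ x in (0:ℝ)..1, min x (1 - x) * (f x ^ 2 + f' x ^ 2) :=
    intervalIntegral.integral_nonneg zero_le_one fun x hx ↦
      mul_nonneg (le_min hx.1 (by linarith [hx.2])) (by positivity)
  have hE : 0 ≤ (∫ x in (0:ℝ)..1, f x ^ 2) +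
      ∫ x in (0:ℝ)..1, ∫ y in (0:ℝ)..1, meanDeriv f' x y ^ 2 :=
    add_nonneg (intervalIntegral.integral_nonneg zero_le_one fun y _ ↦ sq_nonneg _)
      (intervalIntegral.integral_nonneg zero_le_one fun x _ ↦
        intervalIntegral.integral_nonneg zero_le_one fun y _ ↦ sq_nonneg _)
  have h40 : 0 ≤ ∫ x in (0:ℝ)..1, f x ^ 4 :=
    intervalIntegral.integral_nonneg zero_le_one fun y _ ↦ by positivity
  have hb : (∫ x in (0:ℝ)..1, f x ^ 2) +
      ∫ x in (0:ℝ)..1, ∫ y in (0:ℝ)..1, meanDeriv f' x y ^ 2 ≤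
      23 * ∫ x in (0:ℝ)..1, min x (1 - x) * (f x ^ 2 + f' x ^ 2) := by linarith
  generalize (∫ x in (0:ℝ)..1, f x ^ 2) +
      ∫ x in (0:ℝ)..1, ∫ y in (0:ℝ)..1, meanDeriv f' x y ^ 2 = E at *
  constructor
  · rw [one_div, Real.rpow_inv_le_iff_of_pos h40 (by positivity) (by norm_num)]
    have : (2 * √E) ^ (4:ℝ) = 16 * E ^ 2 := by
      rw [show (4:ℝ) = (4:ℕ) by norm_num, Real.rpow_natCast, mul_pow,
        show √E ^ 4 = (√E ^ 2) ^ 2 by ring, Real.sq_sqrt hE]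
      norm_num
    rwa [this]
  · rw [show (10:ℝ) = 2 * 5 by norm_num, mul_assoc]
    gcongr
    rw [Real.sqrt_le_iff]
    refine ⟨by positivity, ?_⟩
    rw [mul_pow, Real.sq_sqrt hX]
    linarith
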